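/- (Linear convergence of the inner level of hierarchical CoCoA.) Suppose σ̄ ≥ 1 is compatible with the inner partition (‖By‖² ≤ σ̄ Σ_{ℓ=1}^L ‖B y_[ℓ]‖² for all y ∈ ℝ^m), c_A > 0 satisfies both Σ_{ℓ=1}^L ‖B y_[ℓ]‖² ≤ c_A ‖y‖² and ‖B y‖² ≥ c_A ‖y‖² for all y ∈ ℝ^m, and G attains its minimum value G*. Let (d^(t))_{t≥0} be a sequence with d^(t+1) = d^(t) + Σ_{ℓ=1}^L Δ_[ℓ]^(t), where each Δ_[ℓ]^(t) is a θ̄-approximate solution of subtask ℓ at d^(t), for some θ̄ ∈ (0,1]. Then the local suboptimality ε̄^(t) := G(d^(t)) − G* satisfies ε̄^(t) ≤ (1 − (1−θ̄)·(q c_A + μ)/(σ̄ q c_A + μ))^t · ε̄^(0) for all t ≥ 0. -/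

import Mathlib

open RealInnerProductSpace Finset

noncomputable section

/-- Matrix–vector product `B y` viewed as a map between Euclidean spaces. -/
def mulVecE {d m : ℕ} (B : Matrix (Fin d) (Fin m) ℝ) (y : EuclideanSpace ℝ (Fin m)) :
    EuclideanSpace ℝ (Fin d) :=
  (WithLp.equiv 2 _).symm (B.mulVec ((WithLp.equiv 2 _) y))

/-- `restr J y` (written `y_[ℓ]` in the paper) equals `y` on the coordinates in `J`
and is zero elsewhere. -/
def restr {m : ℕ} (J : Finset (Fin m)) (y : EuclideanSpace ℝ (Fin m)) :
    EuclideanSpace ℝ (Fin m) :=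
  (WithLp.equiv 2 _).symm (fun i => if i ∈ J then y i else 0)

/-- The local objective `G(d) = c₀ + ⟨w, Bd⟩ + (q/2)‖Bd‖² + ∑ i ḡ i (d i)`. -/
def objG {d m : ℕ} (B : Matrix (Fin d) (Fin m) ℝ) (c₀ : ℝ)
    (w : EuclideanSpace ℝ (Fin d)) (q : ℝ) (gbar : Fin m → ℝ → ℝ)
    (x : EuclideanSpace ℝ (Fin m)) : ℝ :=
  c₀ + ⟪w, mulVecE B x⟫ + q / 2 * ‖mulVecE B x‖ ^ 2 + ∑ i, gbar i (x i)

/-- The inner subtask objective of unit `ℓ`: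
`G_σ̄^{(ℓ)}(Δ; d) = (1/L)[c₀ + ⟨w, v̄⟩ + (q/2)‖v̄‖²] + ⟨w + q v̄, BΔ⟩ + (σ̄q/2)‖BΔ‖²
  + ∑_{i ∈ J_ℓ} ḡ i (d i + Δ i)`, where `v̄ = Bd`. -/
def locG {d m : ℕ} (B : Matrix (Fin d) (Fin m) ℝ) (c₀ : ℝ)
    (w : EuclideanSpace ℝ (Fin d)) (q : ℝ) (gbar : Fin m → ℝ → ℝ)
    (L : ℕ) (σb : ℝ) (Jl : Finset (Fin m))
    (x Δ : EuclideanSpace ℝ (Fin m)) : ℝ :=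
  (1 / (L : ℝ)) * (c₀ + ⟪w, mulVecE B x⟫ + q / 2 * ‖mulVecE B x‖ ^ 2)
    + ⟪w + q • mulVecE B x, mulVecE B Δ⟫ + σb * q / 2 * ‖mulVecE B Δ‖ ^ 2
    + ∑ i ∈ Jl, gbar i (x i + Δ i)

/-- Infimum of the subtask objective of unit `ℓ` over vectors supported on `Jl`. -/
def locGInf {d m : ℕ} (B : Matrix (Fin d) (Fin m) ℝ) (c₀ : ℝ)
    (w : EuclideanSpace ℝ (Fin d)) (q : ℝ) (gbar : Fin m → ℝ → ℝ)
    (L : ℕ) (σb : ℝ) (Jl : Finset (Fin m)) (x : EuclideanSpace ℝ (Fin m)) : ℝ :=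
  sInf ((locG B c₀ w q gbar L σb Jl x) '' {Δ | ∀ i ∉ Jl, Δ i = 0})

/-- `Δl` is a θ̄-approximate solution of subtask `ℓ` at `x`. -/
def IsApproxG {d m : ℕ} (B : Matrix (Fin d) (Fin m) ℝ) (c₀ : ℝ)
    (w : EuclideanSpace ℝ (Fin d)) (q : ℝ) (gbar : Fin m → ℝ → ℝ)
    (L : ℕ) (σb θb : ℝ) (Jl : Finset (Fin m))
    (x Δl : EuclideanSpace ℝ (Fin m)) : Prop :=
  (∀ i ∉ Jl, Δl i = 0) ∧
    locG B c₀ w q gbar L σb Jl x Δl - locGInf B c₀ w q gbar L σb Jl x ≤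
      θb * (locG B c₀ w q gbar L σb Jl x 0 - locGInf B c₀ w q gbar L σb Jl x)

theorem mulVecE_eq_toEuclideanLin {d m : ℕ} (B : Matrix (Fin d) (Fin m) ℝ)
    (y : EuclideanSpace ℝ (Fin m)) : mulVecE B y = Matrix.toEuclideanLin B y := rfl

theorem mulVecE_add {d m : ℕ} (B : Matrix (Fin d) (Fin m) ℝ)
    (y z : EuclideanSpace ℝ (Fin m)) : mulVecE B (y + z) = mulVecE B y + mulVecE B z := by
  simp only [mulVecE_eq_toEuclideanLin, map_add]

theorem mulVecE_smul {d m : ℕ} (B : Matrix (Fin d) (Fin m) ℝ) (s : ℝ)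
    (y : EuclideanSpace ℝ (Fin m)) : mulVecE B (s • y) = s • mulVecE B y := by
  simp only [mulVecE_eq_toEuclideanLin, map_smul]

theorem mulVecE_sum {d m : ℕ} {ι : Type*} (B : Matrix (Fin d) (Fin m) ℝ) (s : Finset ι)
    (y : ι → EuclideanSpace ℝ (Fin m)) :
    mulVecE B (∑ l ∈ s, y l) = ∑ l ∈ s, mulVecE B (y l) := by
  simp only [mulVecE_eq_toEuclideanLin, map_sum]

theorem restr_apply {m : ℕ} (J : Finset (Fin m)) (y : EuclideanSpace ℝ (Fin m)) (i : Fin m) :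
    restr J y i = if i ∈ J then y i else 0 := rfl

theorem restr_zero {m : ℕ} (J : Finset (Fin m)) : restr J 0 = 0 := by
  ext i
  simp [restr_apply]

theorem restr_smul {m : ℕ} (J : Finset (Fin m)) (s : ℝ) (y : EuclideanSpace ℝ (Fin m)) :
    restr J (s • y) = s • restr J y := by
  ext i
  simp [restr_apply]

theorem sum_sum_of_partition {m L : ℕ} {J : Fin L → Finset (Fin m)}
    (hdisj : ∀ l l', l ≠ l' → Disjoint (J l) (J l')) (hcover : ∀ i, ∃ l, i ∈ J l)
    (f : Fin m → ℝ) : ∑ l, ∑ i ∈ J l, f i = ∑ i, f i := by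
  rw [← Finset.sum_biUnion fun l _ l' _ h => hdisj l l' h]
  congr 1
  ext i
  simpa using hcover i

theorem sum_restr {m L : ℕ} {J : Fin L → Finset (Fin m)}
    (hdisj : ∀ l l', l ≠ l' → Disjoint (J l) (J l')) (hcover : ∀ i, ∃ l, i ∈ J l)
    (y : EuclideanSpace ℝ (Fin m)) : ∑ l, restr (J l) y = y := by
  ext i
  obtain ⟨l, hl⟩ := hcover i
  rw [WithLp.ofLp_sum, Finset.sum_apply, Finset.sum_eq_single l]
  · simp [restr_apply, hl]
  · intro l' _ h
    simp [restr_apply, Finset.disjoint_left.mp (hdisj l l' h.symm) hl]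
  · simp

theorem restr_sum_of_support {m L : ℕ} {J : Fin L → Finset (Fin m)}
    (hdisj : ∀ l l', l ≠ l' → Disjoint (J l) (J l'))
    {D : Fin L → EuclideanSpace ℝ (Fin m)} (hD : ∀ l, ∀ i ∉ J l, D l i = 0) (l : Fin L) :
    restr (J l) (∑ l', D l') = D l := by
  ext i
  rw [restr_apply]
  split_ifs with hi
  · rw [WithLp.ofLp_sum, Finset.sum_apply, Finset.sum_eq_single l]
    · intro l' _ h
      exact hD l' i (Finset.disjoint_left.mp (hdisj l l' h.symm) hi)
    · simp
  · exact (hD l i hi).symm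

theorem norm_add_sq_mul {E : Type*} [NormedAddCommGroup E] [InnerProductSpace ℝ E]
    (q : ℝ) (w v z : E) :
    ⟪w, v + z⟫ + q / 2 * ‖v + z‖ ^ 2 =
      ⟪w, v⟫ + q / 2 * ‖v‖ ^ 2 + ⟪w + q • v, z⟫ + q / 2 * ‖z‖ ^ 2 := by
  rw [norm_add_sq_real, inner_add_right, inner_add_left, real_inner_smul_left]
  ring

theorem objG_add {d m : ℕ} (B : Matrix (Fin d) (Fin m) ℝ) (c₀ : ℝ)
    (w : EuclideanSpace ℝ (Fin d)) (q : ℝ) (gbar : Fin m → ℝ → ℝ)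
    (x y : EuclideanSpace ℝ (Fin m)) :
    objG B c₀ w q gbar (x + y) =
      c₀ + ⟪w, mulVecE B x⟫ + q / 2 * ‖mulVecE B x‖ ^ 2
        + ⟪w + q • mulVecE B x, mulVecE B y⟫ + q / 2 * ‖mulVecE B y‖ ^ 2
        + ∑ i, gbar i (x i + y i) := by
  have h := norm_add_sq_mul q w (mulVecE B x) (mulVecE B y)
  simp only [objG, mulVecE_add, PiLp.add_apply]
  linarith

theorem sum_locG_restr {d m L : ℕ} (B : Matrix (Fin d) (Fin m) ℝ) (c₀ : ℝ)
    (w : EuclideanSpace ℝ (Fin d)) (q : ℝ) (gbar : Fin m → ℝ → ℝ) (σb : ℝ)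
    {J : Fin L → Finset (Fin m)} (hL : L ≠ 0)
    (hdisj : ∀ l l', l ≠ l' → Disjoint (J l) (J l')) (hcover : ∀ i, ∃ l, i ∈ J l)
    (x y : EuclideanSpace ℝ (Fin m)) :
    ∑ l, locG B c₀ w q gbar L σb (J l) x (restr (J l) y) =
      c₀ + ⟪w, mulVecE B x⟫ + q / 2 * ‖mulVecE B x‖ ^ 2
        + ⟪w + q • mulVecE B x, mulVecE B y⟫
        + σb * q / 2 * ∑ l, ‖mulVecE B (restr (J l) y)‖ ^ 2
        + ∑ i, gbar i (x i + y i) := by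
  have hL' : (L : ℝ) ≠ 0 := Nat.cast_ne_zero.mpr hL
  have hg : ∑ l, ∑ i ∈ J l, gbar i (x i + restr (J l) y i) = ∑ i, gbar i (x i + y i) := by
    rw [← sum_sum_of_partition hdisj hcover]
    refine Finset.sum_congr rfl fun l _ => Finset.sum_congr rfl fun i hi => ?_
    rw [restr_apply, if_pos hi]
  have hB : ∑ l, ⟪w + q • mulVecE B x, mulVecE B (restr (J l) y)⟫ =
      ⟪w + q • mulVecE B x, mulVecE B y⟫ := by
    rw [← inner_sum, ← mulVecE_sum, sum_restr hdisj hcover]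
  simp only [locG, Finset.sum_add_distrib, hg, hB, ← Finset.mul_sum, Finset.sum_const,
    Finset.card_univ, Fintype.card_fin, nsmul_eq_mul]
  field_simp

theorem bddBelow_locG {d m L : ℕ} (B : Matrix (Fin d) (Fin m) ℝ) (c₀ : ℝ)
    (w : EuclideanSpace ℝ (Fin d)) {q : ℝ} (hq : 0 ≤ q) (gbar : Fin m → ℝ → ℝ) {σb : ℝ}
    (hσb : 1 ≤ σb) (Jl : Finset (Fin m)) {dstar : EuclideanSpace ℝ (Fin m)}
    (hmin : ∀ y, objG B c₀ w q gbar dstar ≤ objG B c₀ w q gbar y)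
    (x : EuclideanSpace ℝ (Fin m)) :
    BddBelow (locG B c₀ w q gbar L σb Jl x '' {Δ | ∀ i ∉ Jl, Δ i = 0}) := by
  set F := c₀ + ⟪w, mulVecE B x⟫ + q / 2 * ‖mulVecE B x‖ ^ 2 with hF
  refine ⟨objG B c₀ w q gbar dstar - F + 1 / (L : ℝ) * F - ∑ i ∈ Jlᶜ, gbar i (x i), ?_⟩
  rintro _ ⟨y, hy, rfl⟩
  have h := hmin (x + y)
  rw [objG_add, ← Finset.sum_add_sum_compl Jl, ← hF] at h
  have hc : ∑ i ∈ Jlᶜ, gbar i (x i + y i) = ∑ i ∈ Jlᶜ, gbar i (x i) :=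
    Finset.sum_congr rfl fun i hi => by rw [hy i (Finset.mem_compl.mp hi), add_zero]
  have hσ : q / 2 * ‖mulVecE B y‖ ^ 2 ≤ σb * q / 2 * ‖mulVecE B y‖ ^ 2 := by
    gcongr
    nlinarith
  rw [locG, ← hF]
  linarith

theorem IsApproxG.locG_le {d m L : ℕ} {B : Matrix (Fin d) (Fin m) ℝ} {c₀ : ℝ}
    {w : EuclideanSpace ℝ (Fin d)} {q : ℝ} {gbar : Fin m → ℝ → ℝ} {σb θb : ℝ}
    {Jl : Finset (Fin m)} {x D : EuclideanSpace ℝ (Fin m)}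
    (h : IsApproxG B c₀ w q gbar L σb θb Jl x D) (hθ : θb ≤ 1)
    (hbdd : BddBelow (locG B c₀ w q gbar L σb Jl x '' {Δ | ∀ i ∉ Jl, Δ i = 0}))
    (y : EuclideanSpace ℝ (Fin m)) :
    locG B c₀ w q gbar L σb Jl x D ≤ θb * locG B c₀ w q gbar L σb Jl x 0 +
      (1 - θb) * locG B c₀ w q gbar L σb Jl x (restr Jl y) := by
  have hinf : locGInf B c₀ w q gbar L σb Jl x ≤ locG B c₀ w q gbar L σb Jl x (restr Jl y) :=
    csInf_le hbdd ⟨_, fun i hi => by rw [restr_apply, if_neg hi], rfl⟩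
  have := mul_le_mul_of_nonneg_left hinf (sub_nonneg.mpr hθ)
  linarith [h.2]

theorem StrongConvexOn.add_mul_sub_le {μ s : ℝ} {g : ℝ → ℝ}
    (hg : StrongConvexOn Set.univ μ g) (hs₀ : 0 ≤ s) (hs₁ : s ≤ 1) (a b : ℝ) :
    g (a + s * (b - a)) ≤ (1 - s) * g a + s * g b - μ / 2 * (s * (1 - s)) * (b - a) ^ 2 := by
  have h := hg.2 (Set.mem_univ a) (Set.mem_univ b) (sub_nonneg.mpr hs₁) hs₀ (by ring)
  simp only [smul_eq_mul, Real.norm_eq_abs, sq_abs] at h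
  rw [show a + s * (b - a) = (1 - s) * a + s * b by ring]
  linarith [h]

/-- The step `s • (z - x)` of length `s = (q c_A + μ) / (σ̄ q c_A + μ)` (stated through the
inequality it satisfies) contracts the separable model towards the value at `z`. -/
theorem sum_locG_smul_sub_le {d m L : ℕ} (B : Matrix (Fin d) (Fin m) ℝ) (c₀ : ℝ)
    (w : EuclideanSpace ℝ (Fin d)) {q : ℝ} (hq : 0 ≤ q)
    {gbar : Fin m → ℝ → ℝ} {μ : ℝ} (hgbar : ∀ i, StrongConvexOn Set.univ μ (gbar i))
    {J : Fin L → Finset (Fin m)} (hL : L ≠ 0)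
    (hdisj : ∀ l l', l ≠ l' → Disjoint (J l) (J l')) (hcover : ∀ i, ∃ l, i ∈ J l)
    {σb : ℝ} (hσb : 0 ≤ σb) {cA : ℝ}
    (hupper : ∀ y : EuclideanSpace ℝ (Fin m),
      ∑ l, ‖mulVecE B (restr (J l) y)‖ ^ 2 ≤ cA * ‖y‖ ^ 2)
    (hlower : ∀ y : EuclideanSpace ℝ (Fin m), cA * ‖y‖ ^ 2 ≤ ‖mulVecE B y‖ ^ 2)
    {s : ℝ} (hs₀ : 0 ≤ s) (hs₁ : s ≤ 1) (hs : s * (σb * q * cA + μ) ≤ q * cA + μ)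
    (x z : EuclideanSpace ℝ (Fin m)) :
    ∑ l, locG B c₀ w q gbar L σb (J l) x (restr (J l) (s • (z - x))) ≤
      (1 - s) * objG B c₀ w q gbar x + s * objG B c₀ w q gbar z := by
  set u := z - x with hu
  have hz := objG_add B c₀ w q gbar x u
  rw [hu, add_sub_cancel, ← hu] at hz
  have hgz : ∑ i, gbar i (x i + u i) = ∑ i, gbar i (z i) :=
    Finset.sum_congr rfl fun i _ => by simp [hu]
  have hg : ∑ i, gbar i (x i + (s • u) i) ≤ (1 - s) * ∑ i, gbar i (x i) +
      s * ∑ i, gbar i (z i) - μ / 2 * (s * (1 - s)) * ‖u‖ ^ 2 := by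
    rw [EuclideanSpace.real_norm_sq_eq, Finset.mul_sum, Finset.mul_sum, Finset.mul_sum,
      ← Finset.sum_add_distrib, ← Finset.sum_sub_distrib]
    exact Finset.sum_le_sum fun i _ => (hgbar i).add_mul_sub_le hs₀ hs₁ (x i) (z i)
  have hn : ∑ l, ‖mulVecE B (restr (J l) (s • u))‖ ^ 2 =
      s ^ 2 * ∑ l, ‖mulVecE B (restr (J l) u)‖ ^ 2 := by
    simp only [restr_smul, mulVecE_smul, norm_smul, mul_pow, Real.norm_eq_abs, sq_abs,
      Finset.mul_sum]
  rw [sum_locG_restr B c₀ w q gbar σb hL hdisj hcover, hn, hz, hgz, mulVecE_smul,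
    real_inner_smul_right, objG]
  have h₁ := mul_le_mul_of_nonneg_left (hupper u) (show 0 ≤ σb * q / 2 * s ^ 2 by positivity)
  have h₂ := mul_le_mul_of_nonneg_left (hlower u) (show 0 ≤ s * q / 2 by positivity)
  have h₃ := mul_le_mul_of_nonneg_left hs (show 0 ≤ s / 2 * ‖u‖ ^ 2 by positivity)
  linarith

theorem objG_add_le_sum_locG_restr {d m L : ℕ} (B : Matrix (Fin d) (Fin m) ℝ) (c₀ : ℝ)
    (w : EuclideanSpace ℝ (Fin d)) {q : ℝ} (hq : 0 ≤ q) (gbar : Fin m → ℝ → ℝ) {σb : ℝ}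
    {J : Fin L → Finset (Fin m)} (hL : L ≠ 0)
    (hdisj : ∀ l l', l ≠ l' → Disjoint (J l) (J l')) (hcover : ∀ i, ∃ l, i ∈ J l)
    (x : EuclideanSpace ℝ (Fin m)) {y : EuclideanSpace ℝ (Fin m)}
    (hy : ‖mulVecE B y‖ ^ 2 ≤ σb * ∑ l, ‖mulVecE B (restr (J l) y)‖ ^ 2) :
    objG B c₀ w q gbar (x + y) ≤
      ∑ l, locG B c₀ w q gbar L σb (J l) x (restr (J l) y) := by
  rw [sum_locG_restr B c₀ w q gbar σb hL hdisj hcover, objG_add]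
  have := mul_le_mul_of_nonneg_left hy (show 0 ≤ q / 2 by positivity)
  linarith

/-- linear convergence of the inner level of hierarchical CoCoA, eq. (3)
of the appendix. `ε̄^(t) ≤ (1 − (1−θ̄)(qc_A + μ)/(σ̄qc_A + μ))^t ε̄^(0)`. -/
theorem stmt_10 {d m L : ℕ} (B : Matrix (Fin d) (Fin m) ℝ) (c₀ : ℝ)
    (w : EuclideanSpace ℝ (Fin d)) (q : ℝ) (hq : 0 < q)
    (gbar : Fin m → ℝ → ℝ) (μ : ℝ) (hμ : 0 ≤ μ)
    (hgbar : ∀ i, StrongConvexOn Set.univ μ (gbar i))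
    (J : Fin L → Finset (Fin m))
    (hne : ∀ l, (J l).Nonempty)
    (hdisj : ∀ l l', l ≠ l' → Disjoint (J l) (J l'))
    (hcover : ∀ i, ∃ l, i ∈ J l)
    (σb : ℝ) (hσb : 1 ≤ σb)
    (hcompat : ∀ y : EuclideanSpace ℝ (Fin m),
      ‖mulVecE B y‖ ^ 2 ≤ σb * ∑ l, ‖mulVecE B (restr (J l) y)‖ ^ 2)
    (cA : ℝ) (hcA : 0 < cA)
    (hupper : ∀ y : EuclideanSpace ℝ (Fin m),
      ∑ l, ‖mulVecE B (restr (J l) y)‖ ^ 2 ≤ cA * ‖y‖ ^ 2)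
    (hlower : ∀ y : EuclideanSpace ℝ (Fin m), cA * ‖y‖ ^ 2 ≤ ‖mulVecE B y‖ ^ 2)
    (dstar : EuclideanSpace ℝ (Fin m))
    (hmin : ∀ y : EuclideanSpace ℝ (Fin m), objG B c₀ w q gbar dstar ≤ objG B c₀ w q gbar y)
    (θb : ℝ) (hθb : θb ∈ Set.Ioc (0 : ℝ) 1)
    (x : ℕ → EuclideanSpace ℝ (Fin m)) (Δ : ℕ → Fin L → EuclideanSpace ℝ (Fin m))
    (happrox : ∀ t l, IsApproxG B c₀ w q gbar L σb θb (J l) (x t) (Δ t l))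
    (hstep : ∀ t, x (t + 1) = x t + ∑ l, Δ t l) :
    ∀ t : ℕ, objG B c₀ w q gbar (x t) - objG B c₀ w q gbar dstar ≤
      (1 - (1 - θb) * ((q * cA + μ) / (σb * q * cA + μ))) ^ t *
        (objG B c₀ w q gbar (x 0) - objG B c₀ w q gbar dstar) := by
  rcases eq_or_ne L 0 with rfl | hL
  · have : IsEmpty (Fin m) := ⟨fun i => (hcover i).choose.elim0⟩
    have hx : ∀ t, x t = dstar := fun t => PiLp.ext fun i => isEmptyElim i
    simp [hx]
  have hσ₀ : 0 < σb := by linarith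
  have hden : 0 < σb * q * cA + μ := by positivity
  set s := (q * cA + μ) / (σb * q * cA + μ) with hs
  have hs₀ : 0 ≤ s := by positivity
  have hs₁ : s ≤ 1 := by
    rw [hs, div_le_one hden]
    nlinarith [mul_pos hq hcA]
  have hs_mul : s * (σb * q * cA + μ) ≤ q * cA + μ := (div_mul_cancel₀ _ hden.ne').le
  have hθ : 0 ≤ 1 - θb := sub_nonneg.mpr hθb.2
  have hrate : 0 ≤ 1 - (1 - θb) * s := by nlinarith [hθb.1]
  have hcontract : ∀ t, objG B c₀ w q gbar (x (t + 1)) - objG B c₀ w q gbar dstar ≤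
      (1 - (1 - θb) * s) * (objG B c₀ w q gbar (x t) - objG B c₀ w q gbar dstar) := by
    intro t
    have hzero : ∑ l, locG B c₀ w q gbar L σb (J l) (x t) 0 = objG B c₀ w q gbar (x t) := by
      have h := sum_locG_restr B c₀ w q gbar σb hL hdisj hcover (x t) 0
      simpa [restr_zero, mulVecE_eq_toEuclideanLin, objG] using h
    have hmodel := objG_add_le_sum_locG_restr B c₀ w hq.le gbar hL hdisj hcover (x t)
      (hcompat (∑ l, Δ t l))
    have happrox_sum := Finset.sum_le_sum fun l (_ : l ∈ Finset.univ) =>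
      (happrox t l).locG_le hθb.2 (bddBelow_locG B c₀ w hq.le gbar hσb (J l) hmin (x t))
        (s • (dstar - x t))
    simp only [restr_sum_of_support hdisj fun l => (happrox t l).1] at hmodel
    rw [Finset.sum_add_distrib, ← Finset.mul_sum, ← Finset.mul_sum, hzero] at happrox_sum
    have hbest := mul_le_mul_of_nonneg_left (sum_locG_smul_sub_le B c₀ w hq.le hgbar hL hdisj
      hcover hσ₀.le hupper hlower hs₀ hs₁ hs_mul (x t) dstar) hθ
    rw [hstep t]
    linarith
  intro t
  induction t with
  | zero => simp
  | succ t ih =>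
    calc _ ≤ _ := hcontract t
      _ ≤ _ := mul_le_mul_of_nonneg_left ih hrate
      _ = _ := by ring
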